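/- arXiv:2406.09697 — 2 statements merged into one kernel-verified Lean document; each statement's English description precedes it below -/
import Mathlib

section
/- Define y : ℕ → ℕ on even arguments by y(0) = 1, y(2) = 1, and y(n) = (n−1)·y(n−2) + (2n−4)·y(n−4) for even n ≥ 4. Then for every even positive integer n, the sum of (det S)² over all Seidel matrices S of order n equals y(n) · (n−1)!! · 2^(n(n−1)/2); that is, the expected value of (det S)² over a uniformly random Seidel matrix of order n is y(n)·(n−1)!!. -/
open Matrix BigOperators

/-- The Seidel matrix of order `n` determined by a choice of sign for each
pair `i < j`; entries below the diagonal are determined by skew-symmetry.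
This is a bijective parametrization of the `2^(n(n-1)/2)` Seidel matrices of
order `n`. -/
def seidelOfSigns (n : ℕ) (ε : {p : Fin n × Fin n // p.1 < p.2} → Bool) :
    Matrix (Fin n) (Fin n) ℤ :=
  Matrix.of fun i j =>
    if h : i < j then (if ε ⟨(i, j), h⟩ then 1 else -1)
    else if h' : j < i then -(if ε ⟨(j, i), h'⟩ then 1 else -1)
    else 0

/-- A Seidel matrix: skew-symmetric, with all off-diagonal entries equal to `1` or `-1`. -/
def IsSeidel {ι : Type*} (S : Matrix ι ι ℤ) : Prop :=
  Sᵀ = -S ∧ ∀ i j, i ≠ j → S i j = 1 ∨ S i j = -1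

theorem IsSeidel.apply_swap {ι : Type*} {S : Matrix ι ι ℤ} (hS : IsSeidel S) (i j : ι) :
    S j i = -S i j :=
  congrFun (congrFun hS.1 i) j

theorem IsSeidel.apply_self {ι : Type*} {S : Matrix ι ι ℤ} (hS : IsSeidel S) (i : ι) :
    S i i = 0 := by
  have := hS.apply_swap i i
  lia

theorem IsSeidel.submatrix {ι κ : Type*} {S : Matrix ι ι ℤ} (hS : IsSeidel S) {f : κ → ι}
    (hf : Function.Injective f) : IsSeidel (S.submatrix f f) :=
  ⟨by ext i j; exact hS.apply_swap _ _, fun _ _ hij => hS.2 _ _ (hf.ne hij)⟩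

theorem isSeidel_seidelOfSigns (n : ℕ) (ε : {p : Fin n × Fin n // p.1 < p.2} → Bool) :
    IsSeidel (seidelOfSigns n ε) := by
  refine ⟨?_, fun i j hij => ?_⟩
  · ext i j
    rcases lt_trichotomy i j with h | rfl | h
    · simp [seidelOfSigns, h, h.not_gt]
    · simp [seidelOfSigns]
    · simp [seidelOfSigns, h, h.not_gt]
  · rcases lt_or_gt_of_ne hij with h | h
    · simp only [seidelOfSigns, of_apply, h, dite_true]
      split_ifs <;> simp
    · simp only [seidelOfSigns, of_apply, h, h.not_gt, dite_true, dite_false]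
      split_ifs <;> simp

theorem seidelOfSigns_injective (n : ℕ) : Function.Injective (seidelOfSigns n) := by
  intro ε δ h
  funext ⟨⟨i, j⟩, hij⟩
  have hij' : i < j := hij
  have := congrFun (congrFun h i) j
  simp only [seidelOfSigns, of_apply, hij', dite_true] at this
  revert this
  cases ε ⟨(i, j), hij⟩ <;> cases δ ⟨(i, j), hij⟩ <;> simp

theorem IsSeidel.exists_signs {n : ℕ} {S : Matrix (Fin n) (Fin n) ℤ} (hS : IsSeidel S) :
    ∃ ε, seidelOfSigns n ε = S := by
  refine ⟨fun p => decide (S p.1.1 p.1.2 = 1), ?_⟩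
  ext i j
  rcases lt_trichotomy i j with h | rfl | h
  · rcases hS.2 i j h.ne with h' | h' <;> simp [seidelOfSigns, h, h']
  · simp [seidelOfSigns, hS.apply_self]
  · have := hS.apply_swap j i
    rcases hS.2 j i h.ne with h' | h' <;> simp [seidelOfSigns, h, h.not_gt, h', this]

/-- The finite set of Seidel matrices of order `n`. -/
def seidelMatrices (n : ℕ) : Finset (Matrix (Fin n) (Fin n) ℤ) :=
  Finset.univ.map ⟨seidelOfSigns n, seidelOfSigns_injective n⟩

theorem mem_seidelMatrices {n : ℕ} {S : Matrix (Fin n) (Fin n) ℤ} :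
    S ∈ seidelMatrices n ↔ IsSeidel S := by
  simp only [seidelMatrices, Finset.mem_map, Finset.mem_univ, true_and,
    Function.Embedding.coeFn_mk]
  exact ⟨fun ⟨ε, h⟩ => h ▸ isSeidel_seidelOfSigns n ε, IsSeidel.exists_signs⟩

theorem sum_seidelMatrices_submatrix {n : ℕ} (e : Equiv.Perm (Fin n))
    (f : Matrix (Fin n) (Fin n) ℤ → ℤ) :
    ∑ S ∈ seidelMatrices n, f (S.submatrix e e) = ∑ S ∈ seidelMatrices n, f S := by
  refine Finset.sum_nbij' (fun S => S.submatrix e e) (fun S => S.submatrix e.symm e.symm)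
    ?_ ?_ ?_ ?_ ?_
  · exact fun S hS => mem_seidelMatrices.2 ((mem_seidelMatrices.1 hS).submatrix e.injective)
  · exact fun S hS => mem_seidelMatrices.2 ((mem_seidelMatrices.1 hS).submatrix e.symm.injective)
  · intro S _; ext; simp
  · intro S _; ext; simp
  · intro S _; rfl

/-- The skew-symmetric extension of `T` by a first row `(0, v)` and first column `(0, -v)`. -/
def skewBorder {n : ℕ} (v : Fin n → ℤˣ) (T : Matrix (Fin n) (Fin n) ℤ) :
    Matrix (Fin (n + 1)) (Fin (n + 1)) ℤ :=
  of (Fin.cons (Fin.cons 0 fun j => (v j : ℤ)) fun i => Fin.cons (-(v i : ℤ)) (T i))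

section skewBorder

variable {n : ℕ} (v : Fin n → ℤˣ) (T : Matrix (Fin n) (Fin n) ℤ)

@[simp] theorem skewBorder_zero_zero : skewBorder v T 0 0 = 0 := rfl

@[simp] theorem skewBorder_zero_succ (j : Fin n) : skewBorder v T 0 j.succ = v j := rfl

@[simp] theorem skewBorder_succ_zero (i : Fin n) : skewBorder v T i.succ 0 = -v i := rfl

@[simp] theorem skewBorder_succ_succ (i j : Fin n) : skewBorder v T i.succ j.succ = T i j := rfl

@[simp] theorem skewBorder_submatrix_succ :
    (skewBorder v T).submatrix Fin.succ Fin.succ = T := rfl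

variable {T} in
theorem IsSeidel.skewBorder (hT : IsSeidel T) : IsSeidel (skewBorder v T) := by
  refine ⟨?_, fun i j hij => ?_⟩
  · ext i j
    cases i using Fin.cases <;> cases j using Fin.cases
    · simp
    · simp
    · simp
    · exact hT.apply_swap _ _
  · cases i using Fin.cases with
    | zero =>
      cases j using Fin.cases with
      | zero => exact absurd rfl hij
      | succ j => rcases Int.units_eq_one_or (v j) with h | h <;> simp [h]
    | succ i =>
      cases j using Fin.cases with
      | zero => rcases Int.units_eq_one_or (v i) with h | h <;> simp [h]
      | succ j => exact hT.2 _ _ fun h => hij (congrArg Fin.succ h)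

end skewBorder

theorem sum_seidelMatrices_succ (n : ℕ)
    (f : Matrix (Fin (n + 1)) (Fin (n + 1)) ℤ → ℤ) :
    ∑ S ∈ seidelMatrices (n + 1), f S =
      ∑ T ∈ seidelMatrices n, ∑ v : Fin n → ℤˣ, f (skewBorder v T) := by
  rw [← Finset.sum_product']
  symm
  refine Finset.sum_bij (fun p _ => skewBorder p.2 p.1) ?_ ?_ ?_ fun _ _ => rfl
  · intro p hp
    exact mem_seidelMatrices.2
      (IsSeidel.skewBorder _ (mem_seidelMatrices.1 (Finset.mem_product.1 hp).1))
  · rintro ⟨T, v⟩ _ ⟨U, w⟩ _ h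
    refine Prod.ext ?_ ?_
    · ext i j
      simpa using congrFun (congrFun h i.succ) j.succ
    · funext j
      ext
      simpa using congrFun (congrFun h 0) j.succ
  · intro S hS
    have hS := mem_seidelMatrices.1 hS
    have hu : ∀ j : Fin n, IsUnit (S 0 j.succ) := fun j =>
      Int.isUnit_iff.2 (hS.2 _ _ (Fin.succ_ne_zero j).symm)
    refine ⟨(S.submatrix Fin.succ Fin.succ, fun j => (hu j).unit), ?_, ?_⟩
    · simpa using mem_seidelMatrices.2 (hS.submatrix (Fin.succ_injective n))
    · ext i j
      cases i using Fin.cases <;> cases j using Fin.cases <;>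
        simp [hS.apply_self, ← hS.apply_swap]

/-! ### Moments of random sign vectors -/

theorem sum_signs_succ {n : ℕ} (f : (Fin (n + 1) → ℤˣ) → ℤ) :
    ∑ v, f v = ∑ u : Fin n → ℤˣ, (f (Fin.cons 1 u) + f (Fin.cons (-1) u)) := by
  rw [← (Fin.consEquiv fun _ => ℤˣ).sum_comp, Fintype.sum_prod_type, Finset.sum_comm]
  refine Finset.sum_congr rfl fun u _ => ?_
  rw [UnitsInt.univ, Finset.sum_pair (by decide)]
  rfl

theorem sum_signs_const (n : ℕ) (c : ℤ) : ∑ _v : Fin n → ℤˣ, c = 2 ^ n * c := by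
  simp

theorem sum_signs_linear_sq {n : ℕ} (c : Fin n → ℤ) :
    ∑ v : Fin n → ℤˣ, (∑ j, c j * v j) ^ 2 = 2 ^ n * ∑ j, c j ^ 2 := by
  induction n with
  | zero => simp
  | succ n ih =>
    have key : ∀ u : Fin n → ℤˣ,
        (∑ j, c j * (Fin.cons 1 u : Fin (n + 1) → ℤˣ) j) ^ 2 +
          (∑ j, c j * (Fin.cons (-1) u : Fin (n + 1) → ℤˣ) j) ^ 2 =
        2 * c 0 ^ 2 + 2 * (∑ j : Fin n, c j.succ * u j) ^ 2 := by
      intro u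
      simp only [Fin.sum_univ_succ, Fin.cons_zero, Fin.cons_succ, Units.val_one, Units.val_neg]
      ring
    rw [sum_signs_succ, Finset.sum_congr rfl fun u _ => key u, Finset.sum_add_distrib,
      sum_signs_const, ← Finset.mul_sum, ih, Fin.sum_univ_succ]
    ring

theorem quadratic_form_cons {n : ℕ} {P : Matrix (Fin (n + 1)) (Fin (n + 1)) ℤ}
    (hP : P.IsSymm) (s : ℤˣ) (u : Fin n → ℤˣ) :
    ∑ i, ∑ j, ((Fin.cons s u : Fin (n + 1) → ℤˣ) i : ℤ) * P i j *
        (Fin.cons s u : Fin (n + 1) → ℤˣ) j =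
      P 0 0 + 2 * s * (∑ j : Fin n, P 0 j.succ * u j) +
        ∑ i : Fin n, ∑ j : Fin n, (u i : ℤ) * P i.succ j.succ * u j := by
  have hs : (s : ℤ) * s = 1 := by
    rcases Int.units_eq_one_or s with rfl | rfl <;> rfl
  simp only [Fin.sum_univ_succ, Fin.cons_zero, Fin.cons_succ, Finset.sum_add_distrib]
  have h1 : ∑ j : Fin n, (s : ℤ) * P 0 j.succ * u j = s * ∑ j : Fin n, P 0 j.succ * u j := by
    simp only [Finset.mul_sum, mul_assoc]
  have h2 : ∑ i : Fin n, (u i : ℤ) * P i.succ 0 * s = s * ∑ j : Fin n, P 0 j.succ * u j := by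
    rw [Finset.mul_sum]
    refine Finset.sum_congr rfl fun i _ => ?_
    rw [hP.apply]
    ring
  rw [h1, h2]
  linear_combination P 0 0 * hs

theorem sum_signs_quadratic {n : ℕ} {P : Matrix (Fin n) (Fin n) ℤ} (hP : P.IsSymm) :
    ∑ v : Fin n → ℤˣ, ∑ i, ∑ j, (v i : ℤ) * P i j * v j = 2 ^ n * ∑ j, P j j := by
  induction n with
  | zero => simp
  | succ n ih =>
    have key : ∀ u : Fin n → ℤˣ, _ := fun u =>
      congrArg₂ (· + ·) (quadratic_form_cons hP 1 u) (quadratic_form_cons hP (-1) u)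
    have ih := ih (hP.submatrix Fin.succ)
    simp only [submatrix_apply] at ih
    rw [sum_signs_succ, Finset.sum_congr rfl fun u _ => (key u).trans (show _ =
      2 * P 0 0 + 2 * ∑ i : Fin n, ∑ j : Fin n, (u i : ℤ) * P i.succ j.succ * u j by
        simp only [Units.val_one, Units.val_neg]; ring), Finset.sum_add_distrib,
      sum_signs_const, ← Finset.mul_sum, ih, Fin.sum_univ_succ]
    ring

theorem sum_signs_quadratic_sq {n : ℕ} {P : Matrix (Fin n) (Fin n) ℤ} (hP : P.IsSymm) :
    ∑ v : Fin n → ℤˣ, (∑ i, ∑ j, (v i : ℤ) * P i j * v j) ^ 2 =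
      2 ^ n * ((∑ j, P j j) ^ 2 + 2 * ∑ i, ∑ j, P i j ^ 2 - 2 * ∑ j, P j j ^ 2) := by
  induction n with
  | zero => simp
  | succ n ih =>
    have key : ∀ u : Fin n → ℤˣ, _ := fun u =>
      congrArg₂ (fun a b => a ^ 2 + b ^ 2)
        (quadratic_form_cons hP 1 u) (quadratic_form_cons hP (-1) u)
    have ih := ih (hP.submatrix Fin.succ)
    have lin := sum_signs_quadratic (hP.submatrix Fin.succ)
    have sq := sum_signs_linear_sq fun j : Fin n => P 0 j.succ
    have col : ∑ i : Fin n, P i.succ 0 ^ 2 = ∑ j : Fin n, P 0 j.succ ^ 2 :=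
      Finset.sum_congr rfl fun i _ => by rw [hP.apply]
    simp only [submatrix_apply] at ih lin
    rw [sum_signs_succ, Finset.sum_congr rfl fun u _ => (key u).trans (show _ =
      2 * P 0 0 ^ 2 +
        4 * P 0 0 * (∑ i : Fin n, ∑ j : Fin n, (u i : ℤ) * P i.succ j.succ * u j) +
        2 * (∑ i : Fin n, ∑ j : Fin n, (u i : ℤ) * P i.succ j.succ * u j) ^ 2 +
        8 * (∑ j : Fin n, P 0 j.succ * u j) ^ 2 by
        simp only [Units.val_one, Units.val_neg]; ring)]
    simp only [Finset.sum_add_distrib, ← Finset.mul_sum, sum_signs_const, ih, lin, sq, col,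
      Fin.sum_univ_succ]
    ring

/-! ### Determinants of bordered matrices -/

theorem det_skewBorder {n : ℕ} (v : Fin (n + 1) → ℤˣ)
    (T : Matrix (Fin (n + 1)) (Fin (n + 1)) ℤ) :
    (skewBorder v T).det = ∑ i, ∑ j, (v i : ℤ) * T.adjugate i j * v j := by
  rw [det_succ_row_zero, Fin.sum_univ_succ]
  simp only [skewBorder_zero_zero, mul_zero, zero_mul, zero_add]
  refine Finset.sum_congr rfl fun k _ => ?_
  rw [det_succ_column_zero, Finset.mul_sum]
  refine Finset.sum_congr rfl fun i _ => ?_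
  have : ((skewBorder v T).submatrix Fin.succ k.succ.succAbove).submatrix i.succAbove Fin.succ =
      T.submatrix i.succAbove k.succAbove := by
    ext a b
    simp
  rw [this, adjugate_fin_succ_eq_det_submatrix]
  simp [pow_add, pow_succ]
  ring

theorem adjugate_mul_adjugate_of_det_eq_zero {ι R : Type*} [Fintype ι] [DecidableEq ι]
    [CommRing R] {A : Matrix ι ι R} (hA : A.det = 0) (i j k l : ι) :
    A.adjugate i j * A.adjugate k l = A.adjugate i l * A.adjugate k j := by
  have hx : A *ᵥ (fun a => A.adjugate a l) = 0 := by
    have h := mul_adjugate A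
    rw [hA, zero_smul] at h
    ext a
    exact congrFun (congrFun h a) l
  have hM : (A.updateRow j (Pi.single k 1)) *ᵥ (fun a => A.adjugate a l) =
      Pi.single j (A.adjugate k l) := by
    ext a
    rcases eq_or_ne a j with rfl | ha
    · simp [mulVec]
    · simpa [mulVec, ha] using congrFun hx a
  have h := congrArg (fun w => ((A.updateRow j (Pi.single k 1)).adjugate *ᵥ w) i) hM
  simp only [mulVec_mulVec, adjugate_mul, smul_mulVec, one_mulVec, Pi.smul_apply,
    smul_eq_mul, mulVec_single, ← adjugate_apply A k j] at h
  simp only [adjugate_apply _ i j, updateRow_idem, col_apply, op_smul_eq_smul,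
    smul_eq_mul] at h
  rw [adjugate_apply A i j]
  linear_combination -h

theorem IsSeidel.det_eq_zero {n : ℕ} (hn : Odd n) {S : Matrix (Fin n) (Fin n) ℤ}
    (hS : IsSeidel S) : S.det = 0 := by
  have h := det_transpose S
  rw [hS.1, det_neg, Fintype.card_fin, hn.neg_one_pow] at h
  lia

theorem IsSeidel.adjugate_isSymm {n : ℕ} (hn : Odd n) {S : Matrix (Fin n) (Fin n) ℤ}
    (hS : IsSeidel S) : S.adjugate.IsSymm := by
  have : Even (n - 1) := Nat.Odd.sub_odd hn odd_one
  rw [IsSymm, adjugate_transpose, hS.1, ← neg_one_smul ℤ S, adjugate_smul, Fintype.card_fin,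
    this.neg_one_pow, one_smul]

/-! ### Recursions for the moments -/

/-- The sum of the squared determinants of the Seidel matrices of order `n`. -/
def sumDetSq (n : ℕ) : ℤ := ∑ S ∈ seidelMatrices n, S.det ^ 2

/-- The sum of the squared traces of the adjugates of the Seidel matrices of order `n`. -/
def sumTraceAdjSq (n : ℕ) : ℤ := ∑ S ∈ seidelMatrices n, (∑ j, S.adjugate j j) ^ 2

theorem sum_signs_det_sq {n : ℕ} (hn : Odd (n + 1))
    {T : Matrix (Fin (n + 1)) (Fin (n + 1)) ℤ} (hT : IsSeidel T) :
    ∑ v, (skewBorder v T).det ^ 2 =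
      2 ^ (n + 1) * (3 * (∑ j, T.adjugate j j) ^ 2 - 2 * ∑ j, T.adjugate j j ^ 2) := by
  have h : ∑ i, ∑ j, T.adjugate i j ^ 2 = (∑ j, T.adjugate j j) ^ 2 := by
    rw [sq, Finset.sum_mul_sum]
    refine Finset.sum_congr rfl fun i _ => Finset.sum_congr rfl fun j _ => ?_
    rw [adjugate_mul_adjugate_of_det_eq_zero (hT.det_eq_zero hn),
      (hT.adjugate_isSymm hn).apply, sq]
  simp only [det_skewBorder]
  rw [sum_signs_quadratic_sq (hT.adjugate_isSymm hn), h]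
  ring

theorem adjugate_zero_zero {n : ℕ} (S : Matrix (Fin (n + 1)) (Fin (n + 1)) ℤ) :
    S.adjugate 0 0 = (S.submatrix Fin.succ Fin.succ).det := by
  simp [adjugate_fin_succ_eq_det_submatrix]

theorem sum_adjugate_sq (n : ℕ) (j : Fin (n + 1)) :
    ∑ S ∈ seidelMatrices (n + 1), S.adjugate j j ^ 2 = 2 ^ n * sumDetSq n := by
  rw [← sum_seidelMatrices_submatrix (Equiv.swap 0 j)]
  simp only [adjugate_submatrix_equiv_self, submatrix_apply, Equiv.swap_apply_right,
    adjugate_zero_zero]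
  rw [sum_seidelMatrices_succ]
  simp only [skewBorder_submatrix_succ, sum_signs_const, ← Finset.mul_sum, sumDetSq]

theorem sumDetSq_add_two {n : ℕ} (hn : Even n) :
    sumDetSq (n + 2) =
      2 ^ (n + 1) * (3 * sumTraceAdjSq (n + 1) - 2 * ((n + 1) * (2 ^ n * sumDetSq n))) := by
  rw [sumDetSq, sum_seidelMatrices_succ,
    Finset.sum_congr rfl fun T hT => sum_signs_det_sq hn.add_one (mem_seidelMatrices.1 hT),
    ← Finset.mul_sum, Finset.sum_sub_distrib, ← Finset.mul_sum, ← Finset.mul_sum,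
    Finset.sum_comm]
  simp [sum_adjugate_sq, sumTraceAdjSq]

theorem skewBorder_submatrix_succAbove_one {n : ℕ} (w : Fin (n + 1) → ℤˣ) (v : Fin n → ℤˣ)
    (U : Matrix (Fin n) (Fin n) ℤ) :
    (skewBorder w (skewBorder v U)).submatrix (Fin.succAbove 1) (Fin.succAbove 1) =
      skewBorder (Fin.tail w) U := by
  ext i j
  rw [← Fin.succ_zero_eq_one]
  cases i using Fin.cases <;> cases j using Fin.cases <;> simp [Fin.tail]

theorem sum_adjugate_mul_adjugate {n : ℕ} (hn : Odd (n + 1)) {j k : Fin (n + 3)} (hjk : j ≠ k) :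
    ∑ S ∈ seidelMatrices (n + 3), S.adjugate j j * S.adjugate k k =
      2 ^ (2 * n + 3) * sumTraceAdjSq (n + 1) := by
  obtain ⟨e, he0, he1⟩ : ∃ e : Equiv.Perm (Fin (n + 3)), e j = 0 ∧ e k = 1 := by
    obtain ⟨e, he⟩ := Equiv.Perm.exists_extending_pair ![j, k] ![0, 1]
      (by simpa [Function.Injective, Fin.forall_fin_two] using ⟨hjk, hjk.symm⟩)
      (by simp [Function.Injective, Fin.forall_fin_two])
    exact ⟨e, he 0, he 1⟩
  rw [← sum_seidelMatrices_submatrix e]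
  simp only [adjugate_submatrix_equiv_self, submatrix_apply, he0, he1, adjugate_zero_zero]
  rw [sum_seidelMatrices_succ, sum_seidelMatrices_succ, sumTraceAdjSq, Finset.mul_sum]
  refine Finset.sum_congr rfl fun U hU => ?_
  have hquad : ∑ v, (skewBorder v U).det = 2 ^ (n + 1) * ∑ j, U.adjugate j j := by
    simp only [det_skewBorder]
    exact sum_signs_quadratic ((mem_seidelMatrices.1 hU).adjugate_isSymm hn)
  have hadj : ∀ (v : Fin (n + 1) → ℤˣ) (w : Fin (n + 2) → ℤˣ),
      (skewBorder w (skewBorder v U)).adjugate 1 1 = (skewBorder (Fin.tail w) U).det := by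
    intro v w
    rw [adjugate_fin_succ_eq_det_submatrix, skewBorder_submatrix_succAbove_one]
    simp
  simp only [hadj, skewBorder_submatrix_succ, sum_signs_succ (n := n + 1), Fin.tail_cons,
    ← two_mul, ← Finset.mul_sum, ← Finset.sum_mul, hquad]
  ring

theorem sumTraceAdjSq_add_three {n : ℕ} (hn : Odd (n + 1)) :
    sumTraceAdjSq (n + 3) = (n + 3) * (2 ^ (n + 2) * sumDetSq (n + 2)) +
      (n + 3) * (n + 2) * (2 ^ (2 * n + 3) * sumTraceAdjSq (n + 1)) := by
  have key : ∀ j k : Fin (n + 3),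
      ∑ S ∈ seidelMatrices (n + 3), S.adjugate j j * S.adjugate k k =
        2 ^ (2 * n + 3) * sumTraceAdjSq (n + 1) +
          if j = k then 2 ^ (n + 2) * sumDetSq (n + 2) -
            2 ^ (2 * n + 3) * sumTraceAdjSq (n + 1) else 0 := by
    intro j k
    split_ifs with h
    · subst h
      simp only [← sq, sum_adjugate_sq]
      ring
    · rw [sum_adjugate_mul_adjugate hn h, add_zero]
  rw [sumTraceAdjSq]
  simp only [sq, Finset.sum_mul_sum]
  rw [Finset.sum_comm, Finset.sum_congr rfl fun j _ => Finset.sum_comm]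
  simp only [key, Finset.sum_add_distrib, Finset.sum_ite_eq, Finset.mem_univ, if_true,
    Finset.sum_const, Finset.card_univ, Fintype.card_fin, nsmul_eq_mul]
  push_cast
  ring

theorem sum_seidelMatrices_zero (f : Matrix (Fin 0) (Fin 0) ℤ → ℤ) :
    ∑ S ∈ seidelMatrices 0, f S = f 0 := by
  have : seidelMatrices 0 = {0} := by
    ext S
    simp [mem_seidelMatrices, IsSeidel, Subsingleton.elim S 0]
  rw [this, Finset.sum_singleton]

theorem sumDetSq_zero : sumDetSq 0 = 1 := by
  rw [sumDetSq, sum_seidelMatrices_zero]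
  simp

theorem sumTraceAdjSq_one : sumTraceAdjSq 1 = 1 := by
  rw [sumTraceAdjSq, sum_seidelMatrices_succ, sum_seidelMatrices_zero]
  simp

theorem sumDetSq_two : sumDetSq 2 = 2 := by
  rw [sumDetSq_add_two (n := 0) (by decide)]
  simp [sumDetSq_zero, sumTraceAdjSq_one]

theorem sumDetSq_add_four {n : ℕ} (hn : Even n) :
    sumDetSq (n + 4) = 2 ^ (2 * n + 5) * (n + 3) ^ 2 * sumDetSq (n + 2) +
      2 ^ (4 * n + 7) * ((n + 1) * (n + 2) * (n + 3)) * sumDetSq n := by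
  have h2 := sumDetSq_add_two hn
  have h4 := sumDetSq_add_two (n := n + 2) (by grind)
  have h3 := sumTraceAdjSq_add_three hn.add_one
  rw [show n + 4 = n + 2 + 2 from rfl, h4, show n + 2 + 1 = n + 3 from rfl, h3]
  push_cast
  linear_combination (-(2 : ℤ) ^ (2 * n + 5) * (n + 3) * (n + 2)) * h2

theorem sumDetSq_eq (y : ℕ → ℕ) (hy0 : y 0 = 1) (hy2 : y 2 = 1)
    (hyrec : ∀ n : ℕ, Even n → 4 ≤ n →
      y n = (n - 1) * y (n - 2) + (2 * n - 4) * y (n - 4)) (m : ℕ) :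
    sumDetSq (2 * m) =
      (y (2 * m) : ℤ) * (Nat.doubleFactorial (2 * m - 1) : ℤ) * 2 ^ (m * (2 * m - 1)) := by
  induction m using Nat.twoStepInduction with
  | zero => simp [sumDetSq_zero, hy0]
  | one => simp [sumDetSq_two, hy2]
  | more m ih0 ih1 =>
    have hy := hyrec (2 * m + 4) ⟨m + 2, by ring⟩ (by lia)
    have hd : (Nat.doubleFactorial (2 * m + 1) : ℤ) =
        (2 * m + 1) * Nat.doubleFactorial (2 * m - 1) := by
      cases m with
      | zero => simp
      | succ m => exact_mod_cast Nat.doubleFactorial_add_two (2 * m + 1)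
    have he : (m + 1) * (2 * m + 1) = m * (2 * m - 1) + (4 * m + 1) := by
      cases m with
      | zero => rfl
      | succ m => simp only [Nat.mul_succ]; grind
    have hd' := Nat.doubleFactorial_add_two (2 * m + 1)
    rw [show 2 * m + 4 - 1 = 2 * m + 3 by lia, show 2 * m + 4 - 2 = 2 * m + 2 by lia,
      show 2 * (2 * m + 4) - 4 = 4 * m + 4 by lia, show 2 * m + 4 - 4 = 2 * m by lia] at hy
    rw [show 2 * (m + 1) = 2 * m + 2 by ring, show 2 * m + 2 - 1 = 2 * m + 1 by lia, hd, he] at ih1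
    rw [show 2 * (m + 2) = 2 * m + 4 by ring, show 2 * m + 4 - 1 = 2 * m + 3 by lia,
      sumDetSq_add_four (even_two_mul m), ih0, ih1, hy, hd',
      show (m + 2) * (2 * m + 3) = m * (2 * m - 1) + (8 * m + 6) by lia]
    push_cast
    rw [hd]
    ring

/-- with `y : ℕ → ℕ` satisfying `y 0 = 1`, `y 2 = 1` and
`y n = (n-1)·y(n-2) + (2n-4)·y(n-4)` for even `n ≥ 4`, the sum of `(det S)²`
over all Seidel matrices of even positive order `n` is
`y n · (n-1)‼ · 2^(n(n-1)/2)`; i.e. the expected value of `(det S)²` is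
`y n · (n-1)‼`. -/
theorem expected_det_sq_seidel (y : ℕ → ℕ)
    (hy0 : y 0 = 1) (hy2 : y 2 = 1)
    (hyrec : ∀ n : ℕ, Even n → 4 ≤ n →
      y n = (n - 1) * y (n - 2) + (2 * n - 4) * y (n - 4)) :
    ∀ n : ℕ, 0 < n → Even n →
      ∑ ε : ({p : Fin n × Fin n // p.1 < p.2} → Bool), ((seidelOfSigns n ε).det) ^ 2
        = (y n : ℤ) * (Nat.doubleFactorial (n - 1) : ℤ) * 2 ^ (n * (n - 1) / 2) := by
  rintro n - ⟨m, rfl⟩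
  have h : (m + m) * (m + m - 1) / 2 = m * (2 * m - 1) := by
    rw [← two_mul, mul_assoc, Nat.mul_div_cancel_left _ two_pos]
  rw [h, ← two_mul, ← sumDetSq_eq y hy0 hy2 hyrec m, sumDetSq, seidelMatrices, Finset.sum_map]
  rfl
end

section
/- Let n be a positive integer and k a natural number with 2k ≤ n. The sum, over all Seidel matrices S of order n, of the coefficient of x^(n−2k) in the characteristic polynomial det(x·I − S) equals C(n, 2k) · (2k−1)!! · 2^(n(n−1)/2). Equivalently, the expected value of this coefficient over a uniformly random Seidel matrix of order n is C(n, 2k)·(2k−1)!!, the number of matchings with exactly k edges in the complete graph K_n. -/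
open Matrix Polynomial BigOperators

/-- Complement the sign that `ε` gives to the pair `e`. -/
def flipSign {n : ℕ} (e : Sym2 (Fin n)) (ε : {p : Fin n × Fin n // p.1 < p.2} → Bool) :
    {p : Fin n × Fin n // p.1 < p.2} → Bool :=
  fun p => if s(p.1.1, p.1.2) = e then !ε p else ε p

lemma flipSign_involutive {n : ℕ} (e : Sym2 (Fin n)) : Function.Involutive (flipSign e) := by
  intro ε
  funext p
  by_cases h : s(p.1.1, p.1.2) = e <;> simp [flipSign, h]

lemma seidelOfSigns_self {n : ℕ} (ε : {p : Fin n × Fin n // p.1 < p.2} → Bool) (i : Fin n) :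
    seidelOfSigns n ε i i = 0 := by
  simp [seidelOfSigns]

lemma seidelOfSigns_mul_swap {n : ℕ} (ε : {p : Fin n × Fin n // p.1 < p.2} → Bool)
    {i j : Fin n} (hij : i ≠ j) :
    seidelOfSigns n ε i j * seidelOfSigns n ε j i = -1 := by
  rcases lt_or_gt_of_ne hij with h | h
  · cases hε : ε ⟨(i, j), h⟩ <;> simp [seidelOfSigns, h, h.not_gt, hε]
  · cases hε : ε ⟨(j, i), h⟩ <;> simp [seidelOfSigns, h, h.not_gt, hε]

lemma seidelOfSigns_flipSign {n : ℕ} (e : Sym2 (Fin n))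
    (ε : {p : Fin n × Fin n // p.1 < p.2} → Bool) (i j : Fin n) :
    seidelOfSigns n (flipSign e ε) i j =
      if s(i, j) = e then -seidelOfSigns n ε i j else seidelOfSigns n ε i j := by
  rcases lt_trichotomy i j with h | rfl | h
  · cases hε : ε ⟨(i, j), h⟩ <;> by_cases he : s(i, j) = e <;>
      simp [seidelOfSigns, flipSign, h, hε, he]
  · simp [seidelOfSigns_self]
  · rw [Sym2.eq_swap (a := i)]
    cases hε : ε ⟨(j, i), h⟩ <;> by_cases he : s(j, i) = e <;>
      simp [seidelOfSigns, flipSign, h, h.not_gt, hε, he]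

/-- A permutation that is not an involution contributes zero to the sum of determinants, because
it uses some unordered pair exactly once. -/
lemma sum_prod_seidelOfSigns_eq_zero {n : ℕ} {s : Finset (Fin n)} (σ : Equiv.Perm s)
    (hσ : σ ^ 2 ≠ 1) :
    ∑ ε, ∏ i, seidelOfSigns n ε (σ i) i = 0 := by
  obtain ⟨a, ha⟩ : ∃ a, σ (σ a) ≠ a := by
    by_contra! h
    exact hσ (Equiv.ext fun x => by simpa [sq] using h x)
  have hneg : ∑ ε, ∏ i, seidelOfSigns n ε (σ i) i = -∑ ε, ∏ i, seidelOfSigns n ε (σ i) i := by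
    conv_lhs => rw [← Equiv.sum_comp (flipSign_involutive s((σ a : Fin n), (a : Fin n))).toPerm]
    rw [← Finset.sum_neg_distrib]
    refine Finset.sum_congr rfl fun ε _ => ?_
    rw [Fintype.prod_eq_mul_prod_compl a, Fintype.prod_eq_mul_prod_compl a, ← neg_mul]
    congr 1
    · simp [seidelOfSigns_flipSign]
    · refine Finset.prod_congr rfl fun i hi => ?_
      have hia : i ≠ a := by simpa using hi
      rw [Function.Involutive.coe_toPerm, seidelOfSigns_flipSign, if_neg]
      rw [Sym2.eq_iff]
      rintro (⟨-, h⟩ | ⟨h, h'⟩)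
      · exact hia (Subtype.ext h)
      · rw [Subtype.ext h'] at h
        exact ha (Subtype.ext h)
  lia

/-- A fixed-point-free involution contributes one to the determinant of each principal minor. -/
lemma sign_mul_prod_seidelOfSigns {n k : ℕ} {s : Finset (Fin n)}
    (ε : {p : Fin n × Fin n // p.1 < p.2} → Bool) (σ : Equiv.Perm s)
    (hσ : σ.cycleType = Multiset.replicate k 2) (hs : s.card = 2 * k) :
    (σ.sign : ℤ) * ∏ i, seidelOfSigns n ε (σ i) i = 1 := by
  have hsign : σ.sign = (-1) ^ k := by
    simp [Equiv.Perm.sign_of_cycleType, hσ, pow_add, pow_mul']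
  have hinv : ∀ i, σ (σ i) = i := by
    have h : σ ^ 2 = 1 := Equiv.Perm.pow_prime_eq_one_iff.mpr fun c hc => by
      rw [hσ] at hc
      exact Multiset.eq_of_mem_replicate hc
    intro i
    simpa [sq] using DFunLike.congr_fun h i
  have hfix : ∀ i, σ i ≠ i := by
    have h : σ.support = Finset.univ := by
      rw [← Finset.card_eq_iff_eq_univ, ← Equiv.Perm.sum_cycleType, hσ]
      simp [hs, mul_comm]
    intro i
    rw [← Equiv.Perm.mem_support, h]
    exact Finset.mem_univ i
  have hlt : ∀ i, ¬ i < σ i ↔ σ i < i := fun i => by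
    rw [not_lt, le_iff_lt_or_eq, or_iff_left (hfix i)]
  have himage : Finset.univ.filter (fun i => ¬ i < σ i) =
      (Finset.univ.filter fun i => i < σ i).map σ.toEmbedding := by
    ext i
    have hi : σ.symm i = σ i := by rw [Equiv.symm_apply_eq, hinv]
    simp only [Finset.mem_filter_univ, Finset.mem_map_equiv, hlt, hi, hinv]
  have hcard : (Finset.univ.filter fun i => i < σ i).card = k := by
    have h := Finset.card_filter_add_card_filter_not (s := Finset.univ) (fun i => i < σ i)
    rw [himage, Finset.card_map, Finset.card_univ, Fintype.card_coe, hs] at h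
    lia
  rw [hsign, ← Finset.prod_filter_mul_prod_filter_not Finset.univ (fun i => i < σ i), himage,
    Finset.prod_map, ← Finset.prod_mul_distrib]
  have hprod : ∀ i ∈ Finset.univ.filter (fun i => i < σ i),
      seidelOfSigns n ε (σ i) i *
        seidelOfSigns n ε (σ (σ.toEmbedding i)) (σ.toEmbedding i) = -1 := by
    intro i _
    rw [Equiv.coe_toEmbedding, hinv]
    exact seidelOfSigns_mul_swap ε fun h => hfix i (Subtype.ext h)
  rw [Finset.prod_congr rfl hprod, Finset.prod_const, hcard]
  simp [← mul_pow]

/-- The fixed-point-free involutions of a set with `2 * k` elements are counted by `(2k-1)‼`. -/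
lemma card_perm_cycleType_replicate_two {α : Type*} [Fintype α] [DecidableEq α] {k : ℕ}
    (hα : Fintype.card α = 2 * k) :
    (Finset.univ.filter fun σ : Equiv.Perm α => σ.cycleType = Multiset.replicate k 2).card =
      Nat.doubleFactorial (2 * k - 1) := by
  have h := Equiv.Perm.card_of_cycleType_mul_eq α (Multiset.replicate k 2)
  have hfact : Nat.factorial (2 * k) =
      Nat.doubleFactorial (2 * k - 1) * (2 ^ k * Nat.factorial k) := by
    rw [← Nat.doubleFactorial_two_mul]
    cases k with
    | zero => rfl
    | succ k => rw [mul_comm (Nat.doubleFactorial _)]; exact Nat.factorial_eq_mul_doubleFactorial _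
  have hcount : ∏ m ∈ (Multiset.replicate k 2).toFinset,
      Nat.factorial ((Multiset.replicate k 2).count m) = Nat.factorial k := by
    rcases eq_or_ne k 0 with rfl | hk
    · simp
    · simp [Multiset.toFinset_replicate, hk]
  rw [if_pos ⟨by simp [hα, mul_comm], fun a ha => (Multiset.eq_of_mem_replicate ha).ge⟩, hcount,
    hα, hfact] at h
  simp only [Multiset.sum_replicate, Multiset.prod_replicate, smul_eq_mul, mul_comm k 2,
    Nat.sub_self, Nat.factorial_zero, one_mul] at h
  exact Nat.eq_of_mul_eq_mul_right (by positivity) h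

lemma card_pairs_lt (n : ℕ) :
    Fintype.card {p : Fin n × Fin n // p.1 < p.2} = n * (n - 1) / 2 := by
  rw [Fintype.card_subtype, Finset.card_filter, Fintype.sum_prod_type_right, ← Finset.sum_range_id,
    ← Fin.sum_univ_eq_sum_range (fun i => i)]
  exact Finset.sum_congr rfl fun i _ => by
    rw [← Finset.card_filter, ← Fin.card_Iio]
    congr 1
    ext j
    simp

/-- The principal minors on a fixed set of `2 * k` indices have average `(2k-1)‼`. -/
lemma sum_det_submatrix_seidelOfSigns {n k : ℕ} {s : Finset (Fin n)} (hs : s.card = 2 * k) :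
    ∑ ε, ((seidelOfSigns n ε).submatrix (Subtype.val : s → Fin n) Subtype.val).det =
      (Nat.doubleFactorial (2 * k - 1) : ℤ) * 2 ^ (n * (n - 1) / 2) := by
  simp only [Matrix.det_apply', Matrix.submatrix_apply, Int.cast_id]
  rw [Finset.sum_comm]
  have hσ : ∀ σ : Equiv.Perm s,
      ∑ ε, ((σ.sign : ℤˣ) : ℤ) * ∏ i, seidelOfSigns n ε (σ i) i =
        if σ.cycleType = Multiset.replicate k 2 then 2 ^ (n * (n - 1) / 2) else 0 := by
    intro σ
    split_ifs with h
    · rw [Finset.sum_congr rfl fun ε _ => sign_mul_prod_seidelOfSigns ε σ h hs]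
      simp [card_pairs_lt]
    · rw [← Finset.mul_sum]
      by_cases hsq : σ ^ 2 = 1
      · have hrep := Equiv.Perm.cycleType_of_pow_prime_eq_one hsq
        obtain ⟨a, ha⟩ : ∃ a, σ a = a := by
          by_contra! hfix
          refine h ?_
          have hsupp : σ.support = Finset.univ := by
            ext i
            simp [hfix i]
          have hsum := σ.sum_cycleType
          rw [hsupp, Finset.card_univ, Fintype.card_coe, hs, hrep, Multiset.sum_replicate,
            smul_eq_mul] at hsum
          rwa [show σ.cycleType.card = k by lia] at hrep
        refine mul_eq_zero_of_right _ (Finset.sum_eq_zero fun ε _ => ?_)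
        refine Finset.prod_eq_zero (Finset.mem_univ a) ?_
        rw [ha, seidelOfSigns_self]
      · rw [sum_prod_seidelOfSigns_eq_zero σ hsq, mul_zero]
  rw [Finset.sum_congr rfl fun σ _ => hσ σ, ← Finset.sum_filter, Finset.sum_const,
    card_perm_cycleType_replicate_two (by simpa using hs), nsmul_eq_mul]

/-- for `2k ≤ n`, the sum over all Seidel matrices of order `n`
of the coefficient of `x^(n-2k)` in the characteristic polynomial equals
`C(n,2k) · (2k-1)‼ · 2^(n(n-1)/2)`, i.e. the expected coefficient is
`C(n,2k)·(2k-1)‼`, the number of `k`-edge matchings of `K_n`. -/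
theorem expected_charpoly_coeff (n k : ℕ) (hn : 0 < n) (hk : 2 * k ≤ n) :
    ∑ ε : ({p : Fin n × Fin n // p.1 < p.2} → Bool),
        (seidelOfSigns n ε).charpoly.coeff (n - 2 * k)
      = (n.choose (2 * k) : ℤ) * (Nat.doubleFactorial (2 * k - 1) : ℤ) *
          2 ^ (n * (n - 1) / 2) := by
  have hcoeff : ∀ ε, (seidelOfSigns n ε).charpoly.coeff (n - 2 * k) =
      ∑ s ∈ Finset.univ.powersetCard (2 * k),
        ((seidelOfSigns n ε).submatrix (Subtype.val : s → Fin n) Subtype.val).det := fun ε => by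
    have h := (seidelOfSigns n ε).charpoly_coeff_eq_sum_minors (2 * k) (by simpa using hk)
    rwa [Fintype.card_fin, pow_mul, neg_one_sq, one_pow, one_mul] at h
  rw [Finset.sum_congr rfl fun ε _ => hcoeff ε, Finset.sum_comm,
    Finset.sum_congr rfl fun s hs =>
      sum_det_submatrix_seidelOfSigns (Finset.mem_powersetCard.mp hs).2]
  simp [mul_assoc]
end
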